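/- Let σ be a distortion function and p ∈ [1,∞) with conjugate exponent q (1/p + 1/q = 1, q = ∞ if p = 1). Then L*_{σ,q}(P) ⊆ L_σ^p(P)^× and sup{|E(ZY)| : Y ∈ L_σ^p(P), ‖Y‖_{σ,p} ≤ 1} ≤ |Z|*_{σ,q} for every Z ∈ L*_{σ,q}(P). -/

import Mathlib

open MeasureTheory
open scoped ENNReal NNReal

noncomputable section

variable {Ω : Type*} [MeasurableSpace Ω]

/-- A `[0,1]`-valued random variable uniformly distributed on `[0,1]`:
`P(U ≤ u) = u` for all `u ∈ [0,1]`. -/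
def IsUniformRV (P : Measure Ω) (U : Ω → ℝ) : Prop :=
  Measurable U ∧ (∀ ω, U ω ∈ Set.Icc (0 : ℝ) 1) ∧
    ∀ u ∈ Set.Icc (0 : ℝ) 1, P {ω | U ω ≤ u} = ENNReal.ofReal u

/-- A distortion function: nondecreasing, nonnegative, left-continuous on `[0,1)`
with `∫₀¹ σ(u) du = 1`. -/
structure IsDistortion (σ : ℝ → ℝ) : Prop where
  nonneg : ∀ u ∈ Set.Ico (0 : ℝ) 1, 0 ≤ σ u
  mono : MonotoneOn σ (Set.Ico (0 : ℝ) 1)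
  left_continuous : ∀ u ∈ Set.Ioo (0 : ℝ) 1,
    Filter.Tendsto σ (nhdsWithin u (Set.Iio u)) (nhds (σ u))
  integral_one : ∫ u in Set.Ioo (0 : ℝ) 1, σ u = 1

/-- `‖Y‖_{σ,p}^p := sup over uniform U of E[σ(U)·‖Y‖^p]`. -/
def sigmaPow (P : Measure Ω) (σ : ℝ → ℝ) (p : ℝ) {X : Type*} [NormedAddCommGroup X]
    (Y : Ω → X) : ℝ≥0∞ :=
  ⨆ (U : Ω → ℝ) (_ : IsUniformRV P U),
    ∫⁻ ω, ENNReal.ofReal (σ (U ω)) * (‖Y ω‖₊ : ℝ≥0∞) ^ p ∂P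

/-- The norm `‖Y‖_{σ,p}`. -/
def sigmaNorm (P : Measure Ω) (σ : ℝ → ℝ) (p : ℝ) {X : Type*} [NormedAddCommGroup X]
    (Y : Ω → X) : ℝ≥0∞ :=
  sigmaPow P σ p Y ^ (1 / p)

/-- Membership in `L_σ^p(P,X)`: strongly measurable with finite `σ,p`-norm. -/
def MemLsigma (P : Measure Ω) (σ : ℝ → ℝ) (p : ℝ) {X : Type*} [NormedAddCommGroup X]
    (Y : Ω → X) : Prop :=
  AEStronglyMeasurable Y P ∧ sigmaPow P σ p Y < ∞

/-- The generalized inverse distribution function (quantile function)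
`F_g^{-1}(α) = inf {q : P(g ≤ q) ≥ α}`. -/
def quantileFn (P : Measure Ω) (g : Ω → ℝ) (α : ℝ) : ℝ :=
  sInf {q : ℝ | ENNReal.ofReal α ≤ P {ω | g ω ≤ q}}

variable {𝕂 : Type*} [RCLike 𝕂]

/-- The Köthe dual of `L_σ^p(P)`:
`{Z measurable : Z·Y ∈ L¹(P) for all Y ∈ L_σ^p(P)}`. -/
def KoetheDual (P : Measure Ω) (σ : ℝ → ℝ) (p : ℝ) (Z : Ω → 𝕂) : Prop :=
  AEStronglyMeasurable Z P ∧
    ∀ Y : Ω → 𝕂, MemLsigma P σ p Y → Integrable (fun ω => Z ω * Y ω) P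

/-- The average value-at-risk of level `α` of the (nonnegative) random variable `g`:
`AV@R_α(g) = (1/(1−α)) ∫_α^1 F_g^{-1}(u) du`. -/
def avar (P : Measure Ω) (g : Ω → ℝ) (α : ℝ) : ℝ≥0∞ :=
  ENNReal.ofReal (1 / (1 - α)) *
    ∫⁻ u in Set.Ioo α 1, ENNReal.ofReal (quantileFn P g u)

/-- `Z'` σ-dominates `Z`: there is a uniform `U` with
`AV@R_α(σ(U)·|Z'|) ≥ AV@R_α(|Z|)` for all `α < 1`. -/
def SigmaDominates (P : Measure Ω) (σ : ℝ → ℝ) (Z' Z : Ω → 𝕂) : Prop :=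
  ∃ U : Ω → ℝ, IsUniformRV P U ∧ ∀ α ∈ Set.Ico (0 : ℝ) 1,
    avar P (fun ω => ‖Z ω‖) α ≤ avar P (fun ω => σ (U ω) * ‖Z' ω‖) α

/-- `|Z|*_{σ,∞} = sup_{α ∈ [0,1)} AV@R_α(|Z|) / ((1/(1−α))·S_σ(α))
 = sup_{α ∈ [0,1)} (∫_α^1 F_{|Z|}^{-1}(u) du) / (∫_α^1 σ(u) du)`. -/
def dualNormInf (P : Measure Ω) (σ : ℝ → ℝ) (Z : Ω → 𝕂) : ℝ≥0∞ :=
  ⨆ (α : ℝ) (_ : α ∈ Set.Ico (0 : ℝ) 1),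
    (∫⁻ u in Set.Ioo α 1, ENNReal.ofReal (quantileFn P (fun ω => ‖Z ω‖) u)) /
      ENNReal.ofReal (∫ u in Set.Ioo α 1, σ u)

/-- `|Z|*_{σ,q} = inf {‖Z'‖_{σ,q} : Z' σ-dominates Z}` (with `inf ∅ = ∞`). -/
def dualNormQ (P : Measure Ω) (σ : ℝ → ℝ) (q : ℝ) (Z : Ω → 𝕂) : ℝ≥0∞ :=
  ⨅ (Z' : Ω → 𝕂) (_ : AEStronglyMeasurable Z' P ∧ SigmaDominates P σ Z' Z),
    sigmaNorm P σ q Z'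

lemma IsUniformRV.map_eq {P : Measure Ω} [IsProbabilityMeasure P] {U : Ω → ℝ}
    (hU : IsUniformRV P U) : P.map U = volume.restrict (Set.Ioo (0 : ℝ) 1) := by
  obtain ⟨hm, hI, hu⟩ := hU
  have := Measure.isProbabilityMeasure_map (μ := P) hm.aemeasurable
  refine Measure.ext_of_Iic _ _ fun a => ?_
  rw [Measure.map_apply hm measurableSet_Iic, Measure.restrict_congr_set Ioo_ae_eq_Icc,
    Measure.restrict_apply measurableSet_Iic]
  have hset : Set.Iic a ∩ Set.Icc (0 : ℝ) 1 = Set.Icc 0 (min a 1) := by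
    ext x; simp only [Set.mem_inter_iff, Set.mem_Iic, Set.mem_Icc, le_min_iff]; tauto
  rw [hset, Real.volume_Icc, sub_zero]
  rcases lt_or_ge a 0 with ha | ha
  · have : U ⁻¹' Set.Iic a = ∅ := by
      ext ω
      simp only [Set.mem_preimage, Set.mem_Iic, Set.mem_empty_iff_false, iff_false, not_le]
      exact ha.trans_le (hI ω).1
    rw [this, measure_empty, ENNReal.ofReal_of_nonpos ((min_le_left _ _).trans ha.le)]
  · rw [← hu (min a 1) ⟨le_min ha zero_le_one, min_le_right _ _⟩]
    congr 1
    ext ω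
    simp only [Set.mem_preimage, Set.mem_Iic, Set.mem_ofPred_eq, le_min_iff]
    exact ⟨fun h => ⟨h, (hI ω).2⟩, fun h => h.1⟩

lemma IsUniformRV.ae_mem_Ioo {P : Measure Ω} [IsProbabilityMeasure P] {U : Ω → ℝ}
    (hU : IsUniformRV P U) : ∀ᵐ ω ∂P, U ω ∈ Set.Ioo (0 : ℝ) 1 := by
  have h : ∀ᵐ u ∂(P.map U), u ∈ Set.Ioo (0 : ℝ) 1 := by
    rw [hU.map_eq]; exact ae_restrict_mem measurableSet_Ioo
  exact ae_of_ae_map hU.1.aemeasurable h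

lemma IsUniformRV.lintegral_comp {P : Measure Ω} [IsProbabilityMeasure P] {U : Ω → ℝ}
    (hU : IsUniformRV P U) {f : ℝ → ℝ≥0∞}
    (hf : AEMeasurable f (volume.restrict (Set.Ioo (0 : ℝ) 1))) :
    ∫⁻ ω, f (U ω) ∂P = ∫⁻ u in Set.Ioo (0 : ℝ) 1, f u := by
  rw [← hU.map_eq] at hf ⊢
  rw [lintegral_map' hf hU.1.aemeasurable]

lemma IsUniformRV.aemeasurable_comp {P : Measure Ω} [IsProbabilityMeasure P] {U : Ω → ℝ}
    (hU : IsUniformRV P U) {β : Type*} [MeasurableSpace β] {f : ℝ → β}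
    (hf : AEMeasurable f (volume.restrict (Set.Ioo (0 : ℝ) 1))) :
    AEMeasurable (fun ω => f (U ω)) P := by
  rw [← hU.map_eq] at hf
  exact hf.comp_measurable hU.1

lemma setLIntegral_comp_le_of_monotoneOn {P : Measure Ω} [IsProbabilityMeasure P] {U : Ω → ℝ}
    (hU : IsUniformRV P U) {f : ℝ → ℝ≥0∞} (hf : MonotoneOn f (Set.Ioo (0 : ℝ) 1))
    (hfin : ∀ u ∈ Set.Ioo (0 : ℝ) 1, f u ≠ ∞) {A : Set Ω} (hA : NullMeasurableSet A P) :
    ∫⁻ ω in A, f (U ω) ∂P ≤ ∫⁻ u in Set.Ioo (1 - (P A).toReal) 1, f u := by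
  have hfm : AEMeasurable f (volume.restrict (Set.Ioo (0 : ℝ) 1)) :=
    aemeasurable_restrict_of_monotoneOn measurableSet_Ioo hf
  have hP1 : (P A).toReal ≤ 1 := ENNReal.toReal_le_of_le_ofReal zero_le_one (by simp [prob_le_one])
  rcases eq_or_lt_of_le (ENNReal.toReal_nonneg (a := P A)) with h0 | h0
  · have : P A = 0 := by
      rcases (ENNReal.toReal_eq_zero_iff _).1 h0.symm with h | h
      · exact h
      · exact absurd h (measure_ne_top _ _)
    simp [Measure.restrict_eq_zero.2 this]
  rcases eq_or_lt_of_le hP1 with h1 | h1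
  · rw [h1, sub_self, ← hU.lintegral_comp hfm]
    exact setLIntegral_le_lintegral _ _
  set a := 1 - (P A).toReal with ha
  have haI : a ∈ Set.Ioo (0 : ℝ) 1 := ⟨by linarith, by linarith⟩
  set B : Set Ω := U ⁻¹' Set.Ioo a 1 with hB
  have hBm : MeasurableSet B := hU.1 measurableSet_Ioo
  have hPB : P B = P A := by
    rw [hB, ← Measure.map_apply hU.1 measurableSet_Ioo, hU.map_eq,
      Measure.restrict_apply measurableSet_Ioo,
      Set.inter_eq_left.2 (Set.Ioo_subset_Ioo_left haI.1.le), Real.volume_Ioo, ha]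
    simp
  have hright : ∫⁻ ω in B, f (U ω) ∂P = ∫⁻ u in Set.Ioo a 1, f u := by
    have hf' : AEMeasurable ((Set.Ioo a 1).indicator f) (volume.restrict (Set.Ioo (0 : ℝ) 1)) :=
      hfm.indicator measurableSet_Ioo
    have := hU.lintegral_comp hf'
    rw [lintegral_indicator measurableSet_Ioo, Measure.restrict_restrict measurableSet_Ioo,
      Set.inter_eq_left.2 (Set.Ioo_subset_Ioo_left haI.1.le)] at this
    rw [← this, ← lintegral_indicator hBm]
    rfl
  have hfU : AEMeasurable (fun ω => f (U ω)) P := hU.aemeasurable_comp hfm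
  have key : ∫⁻ ω in A, f (U ω) ∂P + f a * P B ≤ ∫⁻ ω in B, f (U ω) ∂P + f a * P A := by
    rw [← lintegral_indicator₀ hA, ← lintegral_indicator hBm, ← lintegral_indicator_const hBm,
      ← lintegral_indicator_const₀ hA, ← lintegral_add_left' (hfU.indicator₀ hA),
      ← lintegral_add_left' (hfU.indicator hBm)]
    refine lintegral_mono_ae ?_
    filter_upwards [hU.ae_mem_Ioo] with ω hω
    by_cases h1 : ω ∈ A <;> by_cases h2 : ω ∈ B <;> simp only [h1, h2, Set.indicator_of_mem,
      Set.indicator_of_notMem, not_false_eq_true, add_zero, zero_add, le_refl]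
    · have : U ω ≤ a := by
        by_contra! h; exact h2 ⟨h, hω.2⟩
      exact hf hω haI this
    · exact hf haI hω h2.1.le
  rw [hPB] at key
  rw [← hright]
  exact (ENNReal.add_le_add_iff_right (ENNReal.mul_ne_top (hfin a haI) (measure_ne_top _ _))).1 key

lemma lintegral_mul_le_of_setLIntegral_le {P : Measure Ω} [IsProbabilityMeasure P]
    {w : Ω → ℝ≥0∞} {h : Ω → ℝ} {f : ℝ → ℝ≥0∞} {φ : ℝ → ℝ}
    (hw : AEMeasurable w P) (hh : AEMeasurable h P) (hh0 : 0 ≤ᵐ[P] h)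
    (hf : AEMeasurable f (volume.restrict (Set.Ioo (0 : ℝ) 1)))
    (hφ : MonotoneOn φ (Set.Ioo (0 : ℝ) 1)) (hφ0 : ∀ u ∈ Set.Ioo (0 : ℝ) 1, 0 ≤ φ u)
    (hlaw : ∀ t, P {ω | t < h ω} = volume.restrict (Set.Ioo (0 : ℝ) 1) {u | t < φ u})
    (hwf : ∀ A, NullMeasurableSet A P →
      ∫⁻ ω in A, w ω ∂P ≤ ∫⁻ u in Set.Ioo (1 - (P A).toReal) 1, f u) :
    ∫⁻ ω, w ω * ENNReal.ofReal (h ω) ∂P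
      ≤ ∫⁻ u in Set.Ioo (0 : ℝ) 1, f u * ENNReal.ofReal (φ u) := by
  set μ := volume.restrict (Set.Ioo (0 : ℝ) 1) with hμ
  have hφm : AEMeasurable φ μ := aemeasurable_restrict_of_monotoneOn measurableSet_Ioo hφ
  have hφ0' : 0 ≤ᵐ[μ] φ := by
    filter_upwards [ae_restrict_mem measurableSet_Ioo] with u hu using hφ0 u hu
  have hac1 := withDensity_absolutelyContinuous P w
  have hac2 := withDensity_absolutelyContinuous μ f
  have e1 : ∫⁻ ω, w ω * ENNReal.ofReal (h ω) ∂P = ∫⁻ ω, ENNReal.ofReal (h ω) ∂(P.withDensity w) :=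
    (lintegral_withDensity_eq_lintegral_mul₀ hw hh.ennreal_ofReal).symm
  have e2 : ∫⁻ u, f u * ENNReal.ofReal (φ u) ∂μ
      = ∫⁻ u, ENNReal.ofReal (φ u) ∂(μ.withDensity f) :=
    (lintegral_withDensity_eq_lintegral_mul₀ hf hφm.ennreal_ofReal).symm
  rw [e1, e2, lintegral_eq_lintegral_meas_lt _ (hac1.ae_le hh0) (hh.mono_ac hac1),
    lintegral_eq_lintegral_meas_lt _ (hac2.ae_le hφ0') (hφm.mono_ac hac2)]
  refine lintegral_mono fun t => ?_
  simp only
  rw [withDensity_apply', withDensity_apply']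
  refine (hwf _ (nullMeasurableSet_lt aemeasurable_const hh)).trans ?_
  rw [hlaw t]
  set S : Set ℝ := {u | t < φ u}
  rw [hμ, Measure.restrict_restrict' measurableSet_Ioo]
  refine lintegral_mono_set fun u hu => ?_
  have hS1 : (μ S).toReal ≤ 1 := by
    refine ENNReal.toReal_le_of_le_ofReal zero_le_one ((measure_mono (Set.subset_univ _)).trans ?_)
    simp [hμ]
  have huI : u ∈ Set.Ioo (0 : ℝ) 1 := ⟨by linarith [hu.1], hu.2⟩
  refine ⟨?_, huI⟩
  by_contra hut
  have hsub : S ∩ Set.Ioo 0 1 ⊆ Set.Ioo u 1 := by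
    rintro v ⟨hvS, hv⟩
    refine ⟨?_, hv.2⟩
    by_contra! hvu
    exact hut (lt_of_lt_of_le hvS (hφ hv huI hvu))
  have : (μ S).toReal ≤ 1 - u := by
    refine ENNReal.toReal_le_of_le_ofReal (by linarith [huI.2]) ?_
    rw [hμ, Measure.restrict_apply' measurableSet_Ioo, ← Real.volume_Ioo]
    exact measure_mono hsub
  linarith [hu.1]

lemma tendsto_measure_Iic_atBot_zero (ν : Measure ℝ) [IsProbabilityMeasure ν] :
    Filter.Tendsto (fun x => ν (Set.Iic x)) Filter.atBot (nhds 0) := by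
  simpa [ProbabilityTheory.ofReal_cdf] using
    ENNReal.tendsto_ofReal (ProbabilityTheory.tendsto_cdf_atBot ν)

lemma exists_measure_Iio_le_le_measure_Iic (ν : Measure ℝ) [IsProbabilityMeasure ν] {c : ℝ≥0∞}
    (hc0 : 0 < c) (hc1 : c < 1) : ∃ q : ℝ, ν (Set.Iio q) ≤ c ∧ c ≤ ν (Set.Iic q) := by
  set s : Set ℝ := {q | c ≤ ν (Set.Iic q)}
  have hne : s.Nonempty := by
    have h := tendsto_measure_Iic_atTop ν
    rw [measure_univ] at h
    obtain ⟨q, hq⟩ := (h.eventually_const_lt hc1).exists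
    exact ⟨q, hq.le⟩
  have hbdd : BddBelow s := by
    obtain ⟨q, hq⟩ := ((tendsto_measure_Iic_atBot_zero ν).eventually_lt_const hc0).exists
    refine ⟨q, fun r hr => ?_⟩
    by_contra! hrq
    exact absurd (hr.trans (measure_mono (Set.Iic_subset_Iic.2 hrq.le))) (not_le.2 hq)
  refine ⟨sInf s, ?_, ?_⟩
  · obtain ⟨x, hx, hxlt, hxt⟩ := exists_seq_strictMono_tendsto (sInf s)
    have hU : Set.Iio (sInf s) = ⋃ n, Set.Iic (x n) :=
      (iUnion_Iic_eq_Iio_of_lt_of_tendsto hxlt hxt).symm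
    rw [hU, (show Monotone fun n => Set.Iic (x n) from
      fun m n h => Set.Iic_subset_Iic.2 (hx.monotone h)).measure_iUnion]
    refine iSup_le fun n => ?_
    by_contra! h
    exact absurd (csInf_le hbdd (show x n ∈ s from h.le)) (not_le.2 (hxlt n))
  · obtain ⟨x, hx, hxlt, hxt⟩ := exists_seq_strictAnti_tendsto (sInf s)
    have hI : Set.Iic (sInf s) = ⋂ n, Set.Iic (x n) := by
      ext y
      simp only [Set.mem_Iic, Set.mem_iInter]
      exact ⟨fun h n => h.trans (hxlt n).le, fun h => ge_of_tendsto' hxt h⟩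
    rw [hI, (show Antitone fun n => Set.Iic (x n) from
      fun m n h => Set.Iic_subset_Iic.2 (hx.antitone h)).measure_iInter
        (fun n => measurableSet_Iic.nullMeasurableSet) ⟨0, measure_ne_top _ _⟩]
    refine le_iInf fun n => ?_
    obtain ⟨r, hr, hrx⟩ := exists_lt_of_csInf_lt hne (hxlt n)
    exact le_trans hr (measure_mono (Set.Iic_subset_Iic.2 hrx.le))

lemma quantileFn_nonneg {P : Measure Ω} {g : Ω → ℝ} (hg0 : ∀ ω, 0 ≤ g ω) {α : ℝ} (hα : 0 < α) :
    0 ≤ quantileFn P g α := by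
  refine Real.sInf_nonneg fun q hq => ?_
  by_contra! h
  have : {ω | g ω ≤ q} = ∅ := by
    ext ω
    simpa using h.trans_le (hg0 ω)
  rw [Set.mem_ofPred_eq, this, measure_empty, nonpos_iff_eq_zero, ENNReal.ofReal_eq_zero] at hq
  linarith

lemma quantileFn_congr {P : Measure Ω} {g g' : Ω → ℝ} (h : g =ᵐ[P] g') :
    quantileFn P g = quantileFn P g' := by
  funext α
  unfold quantileFn
  congr 1
  ext q
  have : P {ω | g ω ≤ q} = P {ω | g' ω ≤ q} := by
    refine measure_congr ?_
    filter_upwards [h] with ω hω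
    exact congrArg (· ≤ q) hω
  rw [Set.mem_ofPred_eq, Set.mem_ofPred_eq, this]

section Quantile

variable {P : Measure Ω} [IsProbabilityMeasure P] {g : Ω → ℝ}

lemma bddBelow_quantile_set (hg : AEMeasurable g P) {α : ℝ} (hα : 0 < α) :
    BddBelow {q : ℝ | ENNReal.ofReal α ≤ P {ω | g ω ≤ q}} := by
  have := Measure.isProbabilityMeasure_map (μ := P) hg
  have key := tendsto_measure_Iic_atBot_zero (P.map g)
  obtain ⟨q, hq⟩ := (key.eventually_lt_const (ENNReal.ofReal_pos.2 hα)).exists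
  rw [Measure.map_apply_of_aemeasurable hg measurableSet_Iic] at hq
  refine ⟨q, fun r hr => ?_⟩
  by_contra! hrq
  exact absurd (le_trans hr (measure_mono fun ω (h : g ω ≤ r) => h.trans hrq.le)) (not_le.2 hq)

lemma nonempty_quantile_set (hg : AEMeasurable g P) {α : ℝ} (hα : α < 1) :
    {q : ℝ | ENNReal.ofReal α ≤ P {ω | g ω ≤ q}}.Nonempty := by
  have := Measure.isProbabilityMeasure_map (μ := P) hg
  have key := tendsto_measure_Iic_atTop (P.map g)
  rw [measure_univ] at key
  obtain ⟨q, hq⟩ := (key.eventually_const_lt (show ENNReal.ofReal α < 1 by simpa using hα)).exists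
  rw [Measure.map_apply_of_aemeasurable hg measurableSet_Iic] at hq
  exact ⟨q, hq.le⟩

lemma quantileFn_le (hg : AEMeasurable g P) {α : ℝ} (hα : 0 < α) {q : ℝ}
    (hq : ENNReal.ofReal α ≤ P {ω | g ω ≤ q}) : quantileFn P g α ≤ q :=
  csInf_le (bddBelow_quantile_set hg hα) hq

lemma le_measure_of_quantileFn_lt (hg : AEMeasurable g P) {α : ℝ} (hα : α < 1) {q : ℝ}
    (hq : quantileFn P g α < q) : ENNReal.ofReal α ≤ P {ω | g ω ≤ q} := by
  obtain ⟨r, hr, hrq⟩ := exists_lt_of_csInf_lt (nonempty_quantile_set hg hα) hq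
  exact le_trans hr (measure_mono fun ω (h : g ω ≤ r) => h.trans hrq.le)

lemma monotoneOn_quantileFn (hg : AEMeasurable g P) :
    MonotoneOn (quantileFn P g) (Set.Ioo (0 : ℝ) 1) := fun _ ha _ hb hab =>
  csInf_le_csInf (bddBelow_quantile_set hg ha.1) (nonempty_quantile_set hg hb.2)
    fun _ hq => (ENNReal.ofReal_le_ofReal hab).trans hq

/-- The outcomes at most `ω` in the preorder comparing first `g`, then `U`. -/
def lexBelow (g U : Ω → ℝ) (ω : Ω) : Set Ω :=
  {ω' | g ω' < g ω ∨ g ω' = g ω ∧ U ω' ≤ U ω}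

lemma measurable_measureReal_lexBelow (hg : Measurable g) {U : Ω → ℝ} (hU : Measurable U) :
    Measurable fun ω => P.real (lexBelow g U ω) := by
  have hs : MeasurableSet {x : Ω × Ω | g x.2 < g x.1 ∨ g x.2 = g x.1 ∧ U x.2 ≤ U x.1} := by
    measurability
  exact (measurable_measure_prodMk_left (ν := P) hs).ennreal_toReal

lemma measureReal_lexBelow_lt_le (hg : Measurable g) {U : Ω → ℝ} (hU : IsUniformRV P U) {u : ℝ}
    (hu : u ∈ Set.Ioo (0 : ℝ) 1) :
    P.real {ω | P.real (lexBelow g U ω) < u} ≤ u ∧ u ≤ P.real {ω | P.real (lexBelow g U ω) ≤ u} := by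
  have := Measure.isProbabilityMeasure_map (μ := P) hg.aemeasurable
  obtain ⟨q, hq1, hq2⟩ := exists_measure_Iio_le_le_measure_Iic (P.map g)
    (ENNReal.ofReal_pos.2 hu.1) (show ENNReal.ofReal u < 1 by simpa using hu.2)
  rw [Measure.map_apply hg measurableSet_Iio] at hq1
  rw [Measure.map_apply hg measurableSet_Iic] at hq2
  replace hq1 : P.real (g ⁻¹' Set.Iio q) ≤ u := ENNReal.toReal_le_of_le_ofReal hu.1.le hq1
  replace hq2 : u ≤ P.real (g ⁻¹' Set.Iic q) :=
    (ENNReal.ofReal_le_iff_le_toReal (measure_ne_top _ _)).1 hq2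
  set ψ : ℝ → ℝ := fun s => P.real (g ⁻¹' {q} ∩ U ⁻¹' Set.Iic s) with hψ
  have hD : ∀ s, P.real (g ⁻¹' Set.Iio q ∪ (g ⁻¹' {q} ∩ U ⁻¹' Set.Iic s))
      = P.real (g ⁻¹' Set.Iio q) + ψ s := fun s => by
    refine measureReal_union ?_ ((hg (measurableSet_singleton q)).inter (hU.1 measurableSet_Iic))
    rw [Set.disjoint_left]
    rintro ω (h1 : g ω < q) ⟨h2 : g ω = q, -⟩
    exact h1.ne h2
  have hcont : Continuous ψ := by
    refine (LipschitzWith.of_le_add (f := ψ) fun x y => ?_).continuous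
    have hsub : g ⁻¹' {q} ∩ U ⁻¹' Set.Iic x ⊆
        (g ⁻¹' {q} ∩ U ⁻¹' Set.Iic y) ∪ U ⁻¹' Set.Ioc y x := by
      rintro ω ⟨h1, h2⟩
      rcases le_or_gt (U ω) y with h | h
      · exact Or.inl ⟨h1, h⟩
      · exact Or.inr ⟨h, h2⟩
    have hIoc : P.real (U ⁻¹' Set.Ioc y x) ≤ dist x y := by
      refine ENNReal.toReal_le_of_le_ofReal dist_nonneg ?_
      rw [← Measure.map_apply hU.1 measurableSet_Ioc, hU.map_eq]
      refine (Measure.restrict_apply_le _ _).trans ?_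
      rw [Real.volume_Ioc]
      exact ENNReal.ofReal_le_ofReal (le_abs_self _)
    exact (measureReal_mono hsub).trans ((measureReal_union_le _ _).trans (by gcongr))
  have hlow : P.real (g ⁻¹' Set.Iio q) + ψ (-1) ≤ u := by
    have : g ⁻¹' {q} ∩ U ⁻¹' Set.Iic (-1) = ∅ := by
      ext ω
      simp only [Set.mem_inter_iff, Set.mem_preimage, Set.mem_Iic, Set.mem_empty_iff_false,
        iff_false, not_and, not_le]
      intro _
      linarith [(hU.2.1 ω).1]
    simpa [hψ, this] using hq1
  have hhigh : u ≤ P.real (g ⁻¹' Set.Iio q) + ψ 1 := by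
    rw [← hD 1]
    refine hq2.trans (measureReal_mono fun ω hω => ?_)
    rcases lt_or_eq_of_le (show g ω ≤ q from hω) with h | h
    · exact Or.inl h
    · exact Or.inr ⟨h, (hU.2.1 ω).2⟩
  obtain ⟨s, -, hs⟩ := intermediate_value_Icc (show (-1 : ℝ) ≤ 1 by norm_num)
    ((continuous_const (y := P.real (g ⁻¹' Set.Iio q))).add hcont).continuousOn ⟨hlow, hhigh⟩
  set D := g ⁻¹' Set.Iio q ∪ (g ⁻¹' {q} ∩ U ⁻¹' Set.Iic s) with hDdef
  have hDu : P.real D = u := (hD s).trans hs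
  constructor
  · calc P.real {ω | P.real (lexBelow g U ω) < u} ≤ P.real D := measureReal_mono fun ω hω => ?_
      _ = u := hDu
    by_contra hωD
    refine absurd (show P.real (lexBelow g U ω) < u from hω) (not_lt.2 ?_)
    rw [← hDu]
    refine measureReal_mono fun ω' hω' => ?_
    have hq : q ≤ g ω := not_lt.1 fun h => hωD (Or.inl h)
    rcases hω' with h | ⟨h1, h2⟩
    · exact Or.inl (lt_of_lt_of_le h hq)
    · rcases hq.lt_or_eq with h | h
      · exact Or.inl (lt_of_eq_of_lt h1 h)
      · refine Or.inr ⟨Eq.trans h1 h, le_trans h2 ?_⟩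
        by_contra! hUs
        exact hωD (Or.inr ⟨h.symm, hUs.le⟩)
  · calc u = P.real D := hDu.symm
      _ ≤ _ := measureReal_mono fun ω hω => ?_
    show P.real (lexBelow g U ω) ≤ u
    rw [← hDu]
    refine measureReal_mono fun ω' hω' => ?_
    rcases hω with h | ⟨h1, h2⟩
    · exact Or.inl ((hω'.elim le_of_lt fun h => h.1.le).trans_lt h)
    · rcases hω' with h | ⟨h3, h4⟩
      · exact Or.inl (lt_of_lt_of_eq h h1)
      · exact Or.inr ⟨h3.trans h1, h4.trans h2⟩

lemma isUniformRV_measureReal_lexBelow (hg : Measurable g) {U : Ω → ℝ} (hU : IsUniformRV P U) :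
    IsUniformRV P fun ω => P.real (lexBelow g U ω) := by
  refine ⟨measurable_measureReal_lexBelow hg hU.1, fun ω => ⟨measureReal_nonneg, measureReal_le_one⟩,
    fun u hu => ?_⟩
  rw [← ofReal_measureReal]
  congr 1
  rcases hu.2.eq_or_lt with h1 | h1
  · subst h1
    simp [measureReal_le_one]
  refine le_antisymm ?_ ?_
  · by_contra! h
    obtain ⟨v, huv, hv⟩ := exists_between (lt_min h h1)
    rw [lt_min_iff] at hv
    have h2 := (measureReal_lexBelow_lt_le hg hU ⟨hu.1.trans_lt huv, hv.2⟩).1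
    have h3 : P.real {ω | P.real (lexBelow g U ω) ≤ u} ≤ P.real {ω | P.real (lexBelow g U ω) < v} :=
      measureReal_mono fun ω (hω : _ ≤ u) => lt_of_le_of_lt hω huv
    linarith
  · rcases hu.1.eq_or_lt with h0 | h0
    · rw [← h0]; exact measureReal_nonneg
    · exact (measureReal_lexBelow_lt_le hg hU ⟨h0, h1⟩).2

/-- Every real random variable is almost surely its quantile function applied to some uniform
random variable. -/
lemma exists_isUniformRV_eq_quantileFn (hrich : ∃ U : Ω → ℝ, IsUniformRV P U)
    (hg : AEMeasurable g P) :
    ∃ V : Ω → ℝ, IsUniformRV P V ∧ ∀ᵐ ω ∂P, g ω = quantileFn P g (V ω) := by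
  obtain ⟨U, hU⟩ := hrich
  obtain ⟨g', hg', hgg'⟩ := hg
  rw [quantileFn_congr hgg']
  set V : Ω → ℝ := fun ω => P.real (lexBelow g' U ω) with hV
  have hVu : IsUniformRV P V := isUniformRV_measureReal_lexBelow hg' hU
  have hVle : ∀ ω t, g' ω ≤ t → V ω ≤ P.real {ω | g' ω ≤ t} := fun ω t hωt =>
    measureReal_mono fun ω' hω' => (hω'.elim le_of_lt fun h => h.1.le).trans hωt
  have hlt : ∀ t : ℝ, ∀ᵐ ω ∂P, t < g' ω → P.real {ω | g' ω ≤ t} < V ω := fun t => by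
    set c := P.real {ω | g' ω ≤ t} with hc
    have hle : {ω | g' ω ≤ t} ⊆ {ω | V ω ≤ c} := fun ω hω => hVle ω t hω
    have hmeas : P {ω | V ω ≤ c} = P {ω | g' ω ≤ t} := by
      rw [hVu.2.2 c ⟨measureReal_nonneg, measureReal_le_one⟩, hc, ofReal_measureReal]
    have := ae_eq_of_subset_of_measure_ge hle hmeas.le
      (measurableSet_le hg' measurable_const).nullMeasurableSet (measure_ne_top _ _)
    filter_upwards [this] with ω hω htg
    by_contra! hcV
    exact absurd (hω.mpr hcV) (not_le.2 htg)
  have hall : ∀ᵐ ω ∂P, ∀ r : ℚ, (r : ℝ) < g' ω → P.real {ω | g' ω ≤ r} < V ω :=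
    ae_all_iff.2 fun r => hlt r
  refine ⟨V, hVu, ?_⟩
  filter_upwards [hgg', hall, hVu.ae_mem_Ioo] with ω h1 h2 h3
  rw [h1]
  refine le_antisymm ?_ (quantileFn_le hg'.aemeasurable h3.1 ?_)
  · by_contra! h
    obtain ⟨r, hr1, hr2⟩ := exists_rat_btwn h
    have h4 := le_measure_of_quantileFn_lt hg'.aemeasurable h3.2 hr1
    exact absurd ((ENNReal.ofReal_le_iff_le_toReal (measure_ne_top _ _)).1 h4)
      (not_le.2 (h2 r hr2))
  · exact (ENNReal.ofReal_le_iff_le_toReal (measure_ne_top _ _)).2 (hVle ω _ le_rfl)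

end Quantile

lemma integrable_mul_of_lintegral_lt_top {P : Measure Ω} {Z Y : Ω → 𝕂}
    (hZ : AEStronglyMeasurable Z P)
    (hY : AEStronglyMeasurable Y P) (h : ∫⁻ ω, ‖Z ω‖ₑ * ‖Y ω‖ₑ ∂P < ∞) :
    Integrable (fun ω => Z ω * Y ω) P :=
  ⟨hZ.mul hY, by simpa only [HasFiniteIntegral, enorm_mul] using h⟩

lemma ofReal_norm_integral_mul_le {P : Measure Ω} {Z Y : Ω → 𝕂} :
    ENNReal.ofReal ‖∫ ω, Z ω * Y ω ∂P‖ ≤ ∫⁻ ω, ‖Z ω‖ₑ * ‖Y ω‖ₑ ∂P := by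
  simpa only [ofReal_norm, enorm_mul] using
    enorm_integral_le_lintegral_enorm (μ := P) fun ω => Z ω * Y ω

section Distortion

variable {P : Measure Ω} [IsProbabilityMeasure P] {σ : ℝ → ℝ}

lemma IsUniformRV.measure_lt_eq {V : Ω → ℝ} (hV : IsUniformRV P V) {h : Ω → ℝ} {φ : ℝ → ℝ}
    (hφ : AEMeasurable φ (volume.restrict (Set.Ioo (0 : ℝ) 1))) (hh : ∀ᵐ ω ∂P, h ω = φ (V ω))
    (t : ℝ) : P {ω | t < h ω} = volume.restrict (Set.Ioo (0 : ℝ) 1) {u | t < φ u} := by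
  have hnull := nullMeasurableSet_lt (aemeasurable_const (b := t)) hφ
  rw [← hV.map_eq] at hnull ⊢
  rw [Measure.map_apply₀ hV.1.aemeasurable hnull]
  refine measure_congr ?_
  filter_upwards [hh] with ω hω
  exact congrArg (t < ·) hω

lemma setLIntegral_ofReal_le_quantileFn (hrich : ∃ U : Ω → ℝ, IsUniformRV P U) {g : Ω → ℝ}
    (hg : AEMeasurable g P) {A : Set Ω} (hA : NullMeasurableSet A P) :
    ∫⁻ ω in A, ENNReal.ofReal (g ω) ∂P
      ≤ ∫⁻ u in Set.Ioo (1 - (P A).toReal) 1, ENNReal.ofReal (quantileFn P g u) := by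
  obtain ⟨V, hV, hgV⟩ := exists_isUniformRV_eq_quantileFn hrich hg
  refine le_of_eq_of_le (lintegral_congr_ae ?_) (setLIntegral_comp_le_of_monotoneOn hV
    (f := fun u => ENNReal.ofReal (quantileFn P g u))
    (fun a ha b hb hab => ENNReal.ofReal_le_ofReal (monotoneOn_quantileFn hg ha hb hab))
    (fun _ _ => ENNReal.ofReal_ne_top) hA)
  filter_upwards [ae_restrict_of_ae hgV] with ω hω
  rw [hω]

lemma IsDistortion.monotoneOn_ofReal (hσ : IsDistortion σ) :
    MonotoneOn (fun u => ENNReal.ofReal (σ u)) (Set.Ioo (0 : ℝ) 1) := fun _ ha _ hb hab =>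
  ENNReal.ofReal_le_ofReal (hσ.mono (Set.Ioo_subset_Ico_self ha) (Set.Ioo_subset_Ico_self hb) hab)

lemma IsDistortion.aemeasurable (hσ : IsDistortion σ) :
    AEMeasurable σ (volume.restrict (Set.Ioo (0 : ℝ) 1)) :=
  aemeasurable_restrict_of_monotoneOn measurableSet_Ioo
    (hσ.mono.mono Set.Ioo_subset_Ico_self)

lemma IsDistortion.ofReal_integral (hσ : IsDistortion σ) {α : ℝ} (hα : 0 ≤ α) :
    ENNReal.ofReal (∫ u in Set.Ioo α 1, σ u) = ∫⁻ u in Set.Ioo α 1, ENNReal.ofReal (σ u) := by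
  have hint : IntegrableOn σ (Set.Ioo (0 : ℝ) 1) := by
    by_contra h
    have := hσ.integral_one
    rw [integral_undef h] at this
    exact zero_ne_one this
  refine ofReal_integral_eq_lintegral_ofReal (hint.mono_set (Set.Ioo_subset_Ioo_left hα)) ?_
  filter_upwards [ae_restrict_mem measurableSet_Ioo] with u hu
  exact hσ.nonneg u ⟨hα.trans hu.1.le, hu.2⟩

variable {X : Type*} [NormedAddCommGroup X]

lemma lintegral_quantileFn_rpow_le_sigmaPow (hrich : ∃ U : Ω → ℝ, IsUniformRV P U)
    (hσ : IsDistortion σ) {Y : Ω → X} (hY : AEStronglyMeasurable Y P) (p : ℝ) :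
    ∫⁻ u in Set.Ioo (0 : ℝ) 1,
        ENNReal.ofReal (σ u) * ENNReal.ofReal (quantileFn P (fun ω => ‖Y ω‖) u) ^ p
      ≤ sigmaPow P σ p Y := by
  have hYm : AEMeasurable (fun ω => ‖Y ω‖) P := hY.norm.aemeasurable
  have hφ : AEMeasurable (quantileFn P fun ω => ‖Y ω‖) (volume.restrict (Set.Ioo (0 : ℝ) 1)) :=
    aemeasurable_restrict_of_monotoneOn measurableSet_Ioo (monotoneOn_quantileFn hYm)
  obtain ⟨V, hV, hYV⟩ := exists_isUniformRV_eq_quantileFn hrich hYm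
  rw [← hV.lintegral_comp (hσ.aemeasurable.ennreal_ofReal.fun_mul (hφ.ennreal_ofReal.pow_const p))]
  refine le_of_eq_of_le (lintegral_congr_ae ?_) (le_iSup₂ (f := fun (U : Ω → ℝ)
    (_ : IsUniformRV P U) => ∫⁻ ω, ENNReal.ofReal (σ (U ω)) * (‖Y ω‖₊ : ℝ≥0∞) ^ p ∂P) V hV)
  filter_upwards [hYV] with ω hω
  simp only [← hω, ofReal_norm, enorm_eq_nnnorm]

lemma lintegral_mul_enorm_le_quantileFn (hrich : ∃ U : Ω → ℝ, IsUniformRV P U)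
    {w : Ω → ℝ≥0∞} {f : ℝ → ℝ≥0∞} {Y : Ω → X} (hw : AEMeasurable w P)
    (hf : AEMeasurable f (volume.restrict (Set.Ioo (0 : ℝ) 1))) (hY : AEStronglyMeasurable Y P)
    (hwf : ∀ A, NullMeasurableSet A P →
      ∫⁻ ω in A, w ω ∂P ≤ ∫⁻ u in Set.Ioo (1 - (P A).toReal) 1, f u) :
    ∫⁻ ω, w ω * ‖Y ω‖ₑ ∂P ≤ ∫⁻ u in Set.Ioo (0 : ℝ) 1,
      f u * ENNReal.ofReal (quantileFn P (fun ω => ‖Y ω‖) u) := by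
  have hYm : AEMeasurable (fun ω => ‖Y ω‖) P := hY.norm.aemeasurable
  have hφ := monotoneOn_quantileFn hYm
  obtain ⟨V, hV, hYV⟩ := exists_isUniformRV_eq_quantileFn hrich hYm
  simp only [← ofReal_norm]
  exact lintegral_mul_le_of_setLIntegral_le hw hYm (ae_of_all _ fun ω => norm_nonneg _) hf hφ
    (fun u hu => quantileFn_nonneg (fun ω => norm_nonneg _) hu.1)
    (hV.measure_lt_eq (aemeasurable_restrict_of_monotoneOn measurableSet_Ioo hφ) hYV) hwf

lemma setLIntegral_Ioo_one_sub_le {A : Set Ω} {f g : ℝ → ℝ≥0∞}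
    (h : ∀ α ∈ Set.Ico (0 : ℝ) 1, ∫⁻ u in Set.Ioo α 1, f u ≤ ∫⁻ u in Set.Ioo α 1, g u) :
    ∫⁻ u in Set.Ioo (1 - (P A).toReal) 1, f u ≤ ∫⁻ u in Set.Ioo (1 - (P A).toReal) 1, g u := by
  have hP1 : (P A).toReal ≤ 1 := measureReal_le_one
  rcases (ENNReal.toReal_nonneg (a := P A)).eq_or_lt with h0 | h0
  · simp [← h0]
  · exact h _ ⟨by linarith, by linarith⟩

variable {Z Y : Ω → 𝕂}

lemma lintegral_enorm_mul_le_dualNormInf (hrich : ∃ U : Ω → ℝ, IsUniformRV P U)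
    (hσ : IsDistortion σ) (hZ : AEStronglyMeasurable Z P) (hfin : dualNormInf P σ Z < ∞)
    (hY : AEStronglyMeasurable Y P) :
    ∫⁻ ω, ‖Z ω‖ₑ * ‖Y ω‖ₑ ∂P ≤ dualNormInf P σ Z * sigmaPow P σ 1 Y := by
  set C := dualNormInf P σ Z with hC
  have hquant : ∀ α ∈ Set.Ico (0 : ℝ) 1,
      ∫⁻ u in Set.Ioo α 1, ENNReal.ofReal (quantileFn P (fun ω => ‖Z ω‖) u)
        ≤ ∫⁻ u in Set.Ioo α 1, C * ENNReal.ofReal (σ u) := fun α hα => by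
    rw [lintegral_const_mul' _ _ hfin.ne, ← hσ.ofReal_integral hα.1]
    refine (ENNReal.div_le_iff_le_mul (Or.inr hfin.ne) (Or.inl ENNReal.ofReal_ne_top)).1 ?_
    exact le_iSup₂ (f := fun (α : ℝ) (_ : α ∈ Set.Ico (0 : ℝ) 1) =>
      (∫⁻ u in Set.Ioo α 1, ENNReal.ofReal (quantileFn P (fun ω => ‖Z ω‖) u)) /
        ENNReal.ofReal (∫ u in Set.Ioo α 1, σ u)) α hα
  refine (lintegral_mul_enorm_le_quantileFn hrich hZ.enorm
    (hσ.aemeasurable.ennreal_ofReal.const_mul C) hY fun A hA => ?_).trans ?_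
  · simp only [← ofReal_norm]
    exact (setLIntegral_ofReal_le_quantileFn hrich hZ.norm.aemeasurable hA).trans
      (setLIntegral_Ioo_one_sub_le hquant)
  · simp only [mul_assoc]
    rw [lintegral_const_mul' _ _ hfin.ne]
    gcongr
    simpa only [ENNReal.rpow_one] using lintegral_quantileFn_rpow_le_sigmaPow hrich hσ hY 1

lemma lintegral_enorm_mul_le_sigmaNorm_mul (hrich : ∃ U : Ω → ℝ, IsUniformRV P U)
    (hσ : IsDistortion σ) {p q : ℝ} (hpq : p.HolderConjugate q) {Z' : Ω → 𝕂}
    (hZ : AEStronglyMeasurable Z P) (hZ' : AEStronglyMeasurable Z' P)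
    (hdom : SigmaDominates P σ Z' Z) (hY : AEStronglyMeasurable Y P) :
    ∫⁻ ω, ‖Z ω‖ₑ * ‖Y ω‖ₑ ∂P ≤ sigmaNorm P σ q Z' * sigmaNorm P σ p Y := by
  obtain ⟨U, hU, hdom⟩ := hdom
  set W : Ω → ℝ := fun ω => σ (U ω) * ‖Z' ω‖ with hW
  have hσU : AEMeasurable (fun ω => σ (U ω)) P := hU.aemeasurable_comp hσ.aemeasurable
  have hWm : AEMeasurable W P := hσU.mul hZ'.norm.aemeasurable
  have hYm : AEMeasurable (fun ω => ‖Y ω‖) P := hY.norm.aemeasurable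
  set φ := quantileFn P fun ω => ‖Y ω‖
  have hφmono : MonotoneOn φ (Set.Ioo 0 1) := monotoneOn_quantileFn hYm
  have hφ0 : ∀ u ∈ Set.Ioo (0 : ℝ) 1, 0 ≤ φ u := fun u hu =>
    quantileFn_nonneg (fun ω => norm_nonneg _) hu.1
  have hφ : AEMeasurable φ (volume.restrict (Set.Ioo (0 : ℝ) 1)) :=
    aemeasurable_restrict_of_monotoneOn measurableSet_Ioo hφmono
  have hWq : AEMeasurable (quantileFn P W) (volume.restrict (Set.Ioo (0 : ℝ) 1)) :=
    aemeasurable_restrict_of_monotoneOn measurableSet_Ioo (monotoneOn_quantileFn hWm)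
  obtain ⟨V, hV, hWV⟩ := exists_isUniformRV_eq_quantileFn hrich hWm
  have hquant : ∀ α ∈ Set.Ico (0 : ℝ) 1,
      ∫⁻ u in Set.Ioo α 1, ENNReal.ofReal (quantileFn P (fun ω => ‖Z ω‖) u)
        ≤ ∫⁻ u in Set.Ioo α 1, ENNReal.ofReal (quantileFn P W u) := fun α hα =>
    (ENNReal.mul_le_mul_iff_right
      (ENNReal.ofReal_pos.2 (one_div_pos.2 (sub_pos.2 hα.2))).ne' ENNReal.ofReal_ne_top).1
      (hdom α hα)
  set ν := P.withDensity fun ω => ENNReal.ofReal (σ (U ω)) with hν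
  have hνP : ν ≪ P := withDensity_absolutelyContinuous _ _
  have hφV : AEMeasurable (fun ω => ENNReal.ofReal (φ (V ω))) P :=
    (hV.aemeasurable_comp hφ).ennreal_ofReal
  have hφp : ∫⁻ ω, ENNReal.ofReal (φ (V ω)) ^ p ∂ν ≤ sigmaPow P σ p Y := by
    have hcomp := lintegral_mul_le_of_setLIntegral_le (P := P)
      (w := fun ω => ENNReal.ofReal (σ (U ω))) (h := fun ω => φ (V ω) ^ p)
      (f := fun u => ENNReal.ofReal (σ u)) (φ := fun u => φ u ^ p) hσU.ennreal_ofReal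
      ((hV.aemeasurable_comp hφ).pow_const p)
      (by filter_upwards [hV.ae_mem_Ioo] with ω hω using Real.rpow_nonneg (hφ0 _ hω) p)
      hσ.aemeasurable.ennreal_ofReal
      (fun a ha b hb hab => Real.rpow_le_rpow (hφ0 a ha) (hφmono ha hb hab) hpq.nonneg)
      (fun u hu => Real.rpow_nonneg (hφ0 u hu) p)
      (hV.measure_lt_eq (hφ.pow_const p) (ae_of_all _ fun ω => rfl))
      (fun A hA => setLIntegral_comp_le_of_monotoneOn hU hσ.monotoneOn_ofReal
        (fun _ _ => ENNReal.ofReal_ne_top) hA)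
    rw [hν, lintegral_withDensity_eq_lintegral_mul₀ hσU.ennreal_ofReal (hφV.pow_const p)]
    refine (le_of_eq_of_le (lintegral_congr_ae ?_) hcomp).trans (le_of_eq_of_le
      (lintegral_congr_ae ?_) (lintegral_quantileFn_rpow_le_sigmaPow hrich hσ hY p))
    · filter_upwards [hV.ae_mem_Ioo] with ω hω
      simp only [Pi.mul_apply, ENNReal.ofReal_rpow_of_nonneg (hφ0 _ hω) hpq.nonneg]
    · filter_upwards [ae_restrict_mem measurableSet_Ioo] with u hu
      rw [ENNReal.ofReal_rpow_of_nonneg (hφ0 _ hu) hpq.nonneg]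
  have hZq : ∫⁻ ω, ‖Z' ω‖ₑ ^ q ∂ν ≤ sigmaPow P σ q Z' := by
    rw [hν, lintegral_withDensity_eq_lintegral_mul₀ hσU.ennreal_ofReal (hZ'.enorm.pow_const q)]
    exact le_iSup₂ (f := fun (U : Ω → ℝ) (_ : IsUniformRV P U) =>
      ∫⁻ ω, ENNReal.ofReal (σ (U ω)) * (‖Z' ω‖₊ : ℝ≥0∞) ^ q ∂P) U hU
  calc ∫⁻ ω, ‖Z ω‖ₑ * ‖Y ω‖ₑ ∂P
      ≤ ∫⁻ u in Set.Ioo (0 : ℝ) 1, ENNReal.ofReal (quantileFn P W u) * ENNReal.ofReal (φ u) := by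
        refine lintegral_mul_enorm_le_quantileFn hrich hZ.enorm hWq.ennreal_ofReal hY
          fun A hA => ?_
        simp only [← ofReal_norm]
        exact (setLIntegral_ofReal_le_quantileFn hrich hZ.norm.aemeasurable hA).trans
          (setLIntegral_Ioo_one_sub_le hquant)
    _ = ∫⁻ ω, ((fun ω => ‖Z' ω‖ₑ) * fun ω => ENNReal.ofReal (φ (V ω))) ω ∂ν := by
        rw [← hV.lintegral_comp (hWq.ennreal_ofReal.fun_mul hφ.ennreal_ofReal), hν,
          lintegral_withDensity_eq_lintegral_mul₀ hσU.ennreal_ofReal (hZ'.enorm.mul hφV)]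
        refine lintegral_congr_ae ?_
        filter_upwards [hWV] with ω hω
        rw [← hω]
        simp only [Pi.mul_apply, hW, ENNReal.ofReal_mul' (norm_nonneg _), ofReal_norm, mul_assoc]
    _ ≤ (∫⁻ ω, ‖Z' ω‖ₑ ^ q ∂ν) ^ (1 / q) * (∫⁻ ω, ENNReal.ofReal (φ (V ω)) ^ p ∂ν) ^ (1 / p) :=
        ENNReal.lintegral_mul_le_Lp_mul_Lq ν hpq.symm (hZ'.enorm.mono_ac hνP) (hφV.mono_ac hνP)
    _ ≤ sigmaNorm P σ q Z' * sigmaNorm P σ p Y := by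
        have hp := hpq.nonneg
        have hq := hpq.symm.nonneg
        unfold sigmaNorm
        gcongr

end Distortion

/-- `L*_{σ,q}(P) ⊆ L_σ^p(P)^×` and
`sup{|E(ZY)| : ‖Y‖_{σ,p} ≤ 1} ≤ |Z|*_{σ,q}` for every `Z ∈ L*_{σ,q}(P)`
(`q = ∞` for `p = 1`, conjugate exponent `q` for `p ∈ (1,∞)`). -/
theorem statement11
    (P : Measure Ω) [IsProbabilityMeasure P]
    (hrich : ∃ U : Ω → ℝ, IsUniformRV P U)
    {𝕂 : Type*} [RCLike 𝕂]
    (σ : ℝ → ℝ) (hσ : IsDistortion σ) :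
    -- case p = 1, q = ∞
    (∀ Z : Ω → 𝕂, AEStronglyMeasurable Z P → dualNormInf P σ Z < ∞ →
      KoetheDual P σ 1 Z ∧
      ∀ Y : Ω → 𝕂, MemLsigma P σ 1 Y → sigmaNorm P σ 1 Y ≤ 1 →
        ENNReal.ofReal ‖∫ ω, Z ω * Y ω ∂P‖ ≤ dualNormInf P σ Z) ∧
    -- case p ∈ (1,∞) with conjugate exponent q
    (∀ p q : ℝ, 1 < p → 1 / p + 1 / q = 1 →
      ∀ Z : Ω → 𝕂, AEStronglyMeasurable Z P → dualNormQ P σ q Z < ∞ →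
        KoetheDual P σ p Z ∧
        ∀ Y : Ω → 𝕂, MemLsigma P σ p Y → sigmaNorm P σ p Y ≤ 1 →
          ENNReal.ofReal ‖∫ ω, Z ω * Y ω ∂P‖ ≤ dualNormQ P σ q Z) := by
  constructor
  · intro Z hZ hfin
    refine ⟨⟨hZ, fun Y hY => integrable_mul_of_lintegral_lt_top hZ hY.1 ?_⟩, fun Y hY hY1 => ?_⟩
    · exact (lintegral_enorm_mul_le_dualNormInf hrich hσ hZ hfin hY.1).trans_lt
        (ENNReal.mul_lt_top hfin hY.2)
    · rw [sigmaNorm, one_div_one, ENNReal.rpow_one] at hY1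
      calc _ ≤ _ := ofReal_norm_integral_mul_le
        _ ≤ _ := lintegral_enorm_mul_le_dualNormInf hrich hσ hZ hfin hY.1
        _ ≤ dualNormInf P σ Z * 1 := by gcongr
        _ = _ := mul_one _
  · intro p q hp hpq Z hZ hfin
    have hconj : p.HolderConjugate q :=
      Real.holderConjugate_iff.2 ⟨hp, by simpa only [one_div] using hpq⟩
    refine ⟨⟨hZ, fun Y hY => integrable_mul_of_lintegral_lt_top hZ hY.1 ?_⟩,
      fun Y hY hY1 => le_iInf₂ fun Z' hZ' => ?_⟩
    · simp only [dualNormQ, iInf_lt_iff] at hfin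
      obtain ⟨Z', ⟨hZ'm, hdom⟩, hZ'fin⟩ := hfin
      exact (lintegral_enorm_mul_le_sigmaNorm_mul hrich hσ hconj hZ hZ'm hdom hY.1).trans_lt
        (ENNReal.mul_lt_top hZ'fin
          (ENNReal.rpow_lt_top_of_nonneg (one_div_nonneg.2 hconj.nonneg) hY.2.ne))
    · calc _ ≤ _ := ofReal_norm_integral_mul_le
        _ ≤ _ := lintegral_enorm_mul_le_sigmaNorm_mul hrich hσ hconj hZ hZ'.1 hZ'.2 hY.1
        _ ≤ sigmaNorm P σ q Z' * 1 := by gcongr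
        _ = _ := mul_one _

end
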